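/- A positive real number d has the property that every unit-distance preserving map f : ℝ² → ℂ² satisfies φ₂(f(x),f(y)) = d² for all x,y ∈ ℝ² with |x−y| = d, if and only if d² is a rational number (Corollary 1, A₂(ℂ) = {d > 0 : d² ∈ ℚ}). -/

import Mathlib

open Polynomial IntermediateField in
theorem aux_simple (K : Subfield ℂ) (a t : ℂ) (ha : IsAlgebraic K a) (haK : a ∉ K)
    (h : a ∈ K⟮t⟯) : IsAlgebraic K t := by
  obtain ⟨p, q, hpq⟩ := (mem_adjoin_simple_iff K _).1 h
  have hq : aeval t q ≠ 0 := by
    intro h0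
    rw [h0, div_zero] at hpq
    exact haK (hpq ▸ K.zero_mem)
  have haL : a ∈ algebraicClosure K ℂ := mem_algebraicClosure_iff.2 ha
  set L := algebraicClosure K ℂ
  let a' : L := ⟨a, haL⟩
  have key : IsAlgebraic L t := by
    refine ⟨p.map (algebraMap K L) - C a' * q.map (algebraMap K L), ?_, ?_⟩
    · intro h0
      have hq0 : q ≠ 0 := by rintro rfl; simp at hq
      have hc := congrArg (fun r : L[X] => ((r.coeff q.natDegree : L) : ℂ)) h0
      simp [a'] at hc
      change ((p.coeff q.natDegree : K) : ℂ) - a * ((q.leadingCoeff : K) : ℂ) = 0 at hc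
      have hlc : (q.leadingCoeff : K) ≠ 0 := by simpa using hq0
      have hlc' : ((q.leadingCoeff : K) : ℂ) ≠ 0 := by exact_mod_cast hlc
      apply haK
      have : a = ((p.coeff q.natDegree / q.leadingCoeff : K) : ℂ) := by
        push_cast
        rw [eq_div_iff hlc']
        linear_combination -hc
      rw [this]
      exact Subtype.property _
    · simp only [map_sub, map_mul, aeval_map_algebraMap, aeval_C]
      have : algebraMap L ℂ a' = a := rfl
      rw [this]
      rw [eq_div_iff hq] at hpq
      rw [hpq, sub_self]
  exact key.restrictScalars K

open Polynomial IntermediateField in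
theorem aux_sq (K : Subfield ℂ) (a : ℂ) (ha : Transcendental K a) : a ∉ K⟮a ^ 2⟯ := by
  intro h
  obtain ⟨p, q, hpq⟩ := (mem_adjoin_simple_iff K _).1 h
  have ha0 : a ≠ 0 := by
    rintro rfl
    exact ha isAlgebraic_zero
  have hq : aeval (a ^ 2) q ≠ 0 := by
    intro h0
    rw [h0, div_zero] at hpq
    exact ha0 hpq
  have hq0 : q ≠ 0 := by rintro rfl; simp at hq
  have e : X * expand K 2 q = expand K 2 p := by
    apply (transcendental_iff_injective.1 ha)
    simp only [map_mul, aeval_X, expand_aeval]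
    rw [eq_div_iff hq] at hpq
    exact hpq
  have hd := congrArg natDegree e
  rw [natDegree_X_mul ((expand_ne_zero (by norm_num)).2 hq0), natDegree_expand, natDegree_expand] at hd
  omega

open IntermediateField in
theorem exists_hom_moving (a : ℝ) (ha : ∀ q : ℚ, (q : ℝ) ≠ a) : ∃ σ : ℝ →+* ℂ, σ a ≠ a := by
  have hz : ∃ m : Subfield ℂ, Maximal (fun K => K ∈ {K : Subfield ℂ | (a : ℂ) ∉ K}) m := by
    have := zorn_le_nonempty₀ {K : Subfield ℂ | (a : ℂ) ∉ K} (fun c hc hch y hy => by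
      refine ⟨sSup c, ?_, fun z hz => le_sSup hz⟩
      intro hmem
      rw [Subfield.mem_sSup_of_directedOn ⟨y, hy⟩ hch.directedOn] at hmem
      obtain ⟨s, hs, hs'⟩ := hmem
      exact hc hs hs') ⊥ (by
        intro hmem
        rw [Subfield.bot_eq_of_charZero] at hmem
        obtain ⟨q, hq⟩ := hmem
        apply ha q
        have : ((q : ℝ) : ℂ) = (a : ℂ) := by simpa using hq
        exact_mod_cast this)
    obtain ⟨m, -, hm⟩ := this
    exact ⟨m, hm⟩
  obtain ⟨K, hK, hmax⟩ := hz
  have hmax' : ∀ t : ℂ, (a : ℂ) ∉ K⟮t⟯ → t ∈ K := by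
    intro t ht
    have hle : K ≤ K⟮t⟯.toSubfield := fun x hx => K⟮t⟯.algebraMap_mem ⟨x, hx⟩
    exact hmax (y := K⟮t⟯.toSubfield) ht hle (mem_adjoin_simple_self K t)
  have halg : IsAlgebraic K (a : ℂ) := by
    by_contra htr
    have h2 := hmax' _ (aux_sq K a htr)
    apply htr
    have : IsAlgebraic K ((a : ℂ) ^ 2) := isAlgebraic_algebraMap (⟨_, h2⟩ : K)
    exact (isAlgebraic_iff_isIntegral.1 this).of_pow (by norm_num) |>.isAlgebraic
  have hall : Algebra.IsAlgebraic K ℂ := by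
    refine ⟨fun t => ?_⟩
    by_cases h : (a : ℂ) ∈ K⟮t⟯
    · exact aux_simple K a t halg hK h
    · exact isAlgebraic_algebraMap (⟨_, hmax' t h⟩ : K)
  have hclosure : IsAlgClosure K ℂ := ⟨inferInstance, hall⟩
  have : IsGalois K ℂ := ⟨⟩
  by_contra! hc
  apply hK
  have := (InfiniteGalois.mem_range_algebraMap_iff_fixed (k := K) (K := ℂ) (a : ℂ)).2
    (fun g => hc ((g : ℂ →+* ℂ).comp (algebraMap ℝ ℂ)))
  obtain ⟨y, hy⟩ := this
  rw [← hy]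
  exact y.2

/-- The map with coordinate functions `u`, `v` preserves squared distance `s`. -/
def PresSq (u v : ℝ → ℝ → ℂ) (s : ℝ) : Prop :=
  ∀ x1 x2 y1 y2 : ℝ, (x1 - y1) ^ 2 + (x2 - y2) ^ 2 = s →
    (u x1 x2 - u y1 y2) ^ 2 + (v x1 x2 - v y1 y2) ^ 2 = (s : ℂ)

theorem apex (x1 x2 y1 y2 D s : ℝ) (hD : 0 < D) (h : (x1 - y1) ^ 2 + (x2 - y2) ^ 2 = D)
    (hs : D ≤ 4 * s) : ∃ h : ℝ, ∃ z1 z2 w1 w2 : ℝ,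
      (z1 - x1) ^ 2 + (z2 - x2) ^ 2 = s ∧ (z1 - y1) ^ 2 + (z2 - y2) ^ 2 = s ∧
      (w1 - x1) ^ 2 + (w2 - x2) ^ 2 = s ∧ (w1 - y1) ^ 2 + (w2 - y2) ^ 2 = s ∧
      (z1 - w1) ^ 2 + (z2 - w2) ^ 2 = 4 * s - D := by
  obtain ⟨k, hk⟩ : ∃ k : ℝ, k ^ 2 * D = s - D / 4 := by
    refine ⟨√((s - D / 4) / D), ?_⟩
    rw [Real.sq_sqrt (div_nonneg (by linarith) hD.le)]
    field_simp
  refine ⟨k, (x1 + y1) / 2 - k * (y2 - x2), (x2 + y2) / 2 + k * (y1 - x1),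
    (x1 + y1) / 2 + k * (y2 - x2), (x2 + y2) / 2 - k * (y1 - x1), ?_, ?_, ?_, ?_, ?_⟩
  · linear_combination hk + (k ^ 2 + 1 / 4) * h
  · linear_combination hk + (k ^ 2 + 1 / 4) * h
  · linear_combination hk + (k ^ 2 + 1 / 4) * h
  · linear_combination hk + (k ^ 2 + 1 / 4) * h
  · linear_combination 4 * hk + 4 * k ^ 2 * h

theorem vec_zero (p1 p2 c1 c2 s : ℂ) (hs : s ≠ 0) (hc : c1 ^ 2 + c2 ^ 2 = s)
    (h1 : p1 * c1 + p2 * c2 = 0) (h2 : p1 * c2 - p2 * c1 = 0) : p1 = 0 ∧ p2 = 0 := by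
  constructor
  · apply (mul_eq_zero.1 (?_ : s * p1 = 0)).resolve_left hs
    linear_combination -p1 * hc + c1 * h1 + c2 * h2
  · apply (mul_eq_zero.1 (?_ : s * p2 = 0)).resolve_left hs
    linear_combination -p2 * hc + c2 * h1 - c1 * h2

theorem kite_image (x1 x2 y1 y2 z1 z2 w1 w2 a b : ℂ) (ha : a ≠ 0)
    (hzw : (z1 - w1) ^ 2 + (z2 - w2) ^ 2 = a)
    (hzx : (z1 - x1) ^ 2 + (z2 - x2) ^ 2 = b) (hzy : (z1 - y1) ^ 2 + (z2 - y2) ^ 2 = b)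
    (hwx : (w1 - x1) ^ 2 + (w2 - x2) ^ 2 = b) (hwy : (w1 - y1) ^ 2 + (w2 - y2) ^ 2 = b) :
    (x1 = y1 ∧ x2 = y2) ∨ (x1 - y1) ^ 2 + (x2 - y2) ^ 2 = 4 * b - a := by
  obtain ⟨p1, hp1⟩ : ∃ p, p = x1 - (z1 + w1) / 2 := ⟨_, rfl⟩
  obtain ⟨p2, hp2⟩ : ∃ p, p = x2 - (z2 + w2) / 2 := ⟨_, rfl⟩
  obtain ⟨r1, hr1⟩ : ∃ p, p = y1 - (z1 + w1) / 2 := ⟨_, rfl⟩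
  obtain ⟨r2, hr2⟩ : ∃ p, p = y2 - (z2 + w2) / 2 := ⟨_, rfl⟩
  obtain ⟨c1, hc1⟩ : ∃ p, p = z1 - w1 := ⟨_, rfl⟩
  obtain ⟨c2, hc2⟩ : ∃ p, p = z2 - w2 := ⟨_, rfl⟩
  have hc : c1 ^ 2 + c2 ^ 2 = a := by rw [hc1, hc2]; exact hzw
  have e1 : p1 * c1 + p2 * c2 = 0 := by
    subst hp1 hp2 hc1 hc2; linear_combination (hwx - hzx) / 2
  have e2 : r1 * c1 + r2 * c2 = 0 := by
    subst hr1 hr2 hc1 hc2; linear_combination (hwy - hzy) / 2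
  have n1 : p1 ^ 2 + p2 ^ 2 = b - a / 4 := by
    subst hp1 hp2; linear_combination (hwx + hzx) / 2 - hzw / 4
  have n2 : r1 ^ 2 + r2 ^ 2 = b - a / 4 := by
    subst hr1 hr2; linear_combination (hwy + hzy) / 2 - hzw / 4
  have hprod : ((p1 - r1) * c2 - (p2 - r2) * c1) * ((p1 + r1) * c2 - (p2 + r2) * c1) = 0 := by
    linear_combination (c1 ^ 2 + c2 ^ 2) * (n1 - n2) - (p1 * c1 + p2 * c2) * e1
      + (r1 * c1 + r2 * c2) * e2
  rcases mul_eq_zero.1 hprod with h | h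
  · left
    obtain ⟨h1, h2⟩ := vec_zero (p1 - r1) (p2 - r2) c1 c2 a ha hc (by linear_combination e1 - e2) h
    constructor
    · linear_combination h1 - hp1 + hr1
    · linear_combination h2 - hp2 + hr2
  · right
    obtain ⟨h1, h2⟩ := vec_zero (p1 + r1) (p2 + r2) c1 c2 a ha hc (by linear_combination e1 + e2) h
    have g1 : x1 - y1 = 2 * p1 := by linear_combination -hp1 + hr1 - h1
    have g2 : x2 - y2 = 2 * p2 := by linear_combination -hp2 + hr2 - h2
    rw [g1, g2]
    linear_combination 4 * n1

section
variable {u v : ℝ → ℝ → ℂ}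

theorem dichot {a b : ℝ} (ha : PresSq u v a) (hb : PresSq u v b) (ha0 : 0 < a) (hab : a < 4 * b)
    (x1 x2 y1 y2 : ℝ) (h : (x1 - y1) ^ 2 + (x2 - y2) ^ 2 = 4 * b - a) :
    (u x1 x2 = u y1 y2 ∧ v x1 x2 = v y1 y2) ∨
      (u x1 x2 - u y1 y2) ^ 2 + (v x1 x2 - v y1 y2) ^ 2 = ((4 * b - a : ℝ) : ℂ) := by
  obtain ⟨-, z1, z2, w1, w2, h1, h2, h3, h4, h5⟩ :=
    apex x1 x2 y1 y2 (4 * b - a) b (by linarith) h (by linarith)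
  have := kite_image (u x1 x2) (v x1 x2) (u y1 y2) (v y1 y2) (u z1 z2) (v z1 z2) (u w1 w2)
    (v w1 w2) a b (by exact_mod_cast ha0.ne') (ha _ _ _ _ (by linarith)) (hb _ _ _ _ h1)
    (hb _ _ _ _ h2) (hb _ _ _ _ h3) (hb _ _ _ _ h4)
  push_cast
  exact this

theorem kite {a b r : ℝ} (ha : PresSq u v a) (hb : PresSq u v b) (hr : PresSq u v r)
    (ha0 : 0 < a) (hab : a < 4 * b) (hr0 : 0 < r) (hr1 : r < 4 * (4 * b - a))
    (hr2 : r ≠ 4 * b - a) : PresSq u v (4 * b - a) := by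
  intro x1 x2 y1 y2 h
  rcases dichot ha hb ha0 hab x1 x2 y1 y2 h with ⟨e1, e2⟩ | h'
  swap
  · exact h'
  exfalso
  obtain ⟨D, hD⟩ : ∃ D, D = 4 * b - a := ⟨_, rfl⟩
  have hD0 : 0 < D := by linarith
  rw [← hD] at hr1 hr2 h
  obtain ⟨c, hc⟩ : ∃ c, c = 1 - r / (2 * D) := ⟨_, rfl⟩
  have hcD : 2 * D * (1 - c) = r := by rw [hc]; field_simp; ring
  have hc1 : c < 1 := by nlinarith
  have hc2 : -1 < c := by nlinarith
  obtain ⟨t, ht⟩ : ∃ t : ℝ, t ^ 2 = 1 - c ^ 2 := ⟨√(1 - c ^ 2), Real.sq_sqrt (by nlinarith)⟩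
  obtain ⟨z1, hz1⟩ : ∃ z, z = x1 + (c * (y1 - x1) - t * (y2 - x2)) := ⟨_, rfl⟩
  obtain ⟨z2, hz2⟩ : ∃ z, z = x2 + (t * (y1 - x1) + c * (y2 - x2)) := ⟨_, rfl⟩
  have k1 : (x1 - z1) ^ 2 + (x2 - z2) ^ 2 = D := by
    subst hz1 hz2; linear_combination (c ^ 2 + t ^ 2) * h + D * ht
  have k2 : (y1 - z1) ^ 2 + (y2 - z2) ^ 2 = r := by
    subst hz1 hz2
    linear_combination ((1 - c) ^ 2 + t ^ 2) * h + D * ht + hcD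
  have m2 := hr _ _ _ _ k2
  rw [hD] at k1
  rcases dichot ha hb ha0 hab x1 x2 z1 z2 k1 with ⟨f1, f2⟩ | h'
  · rw [← e1, ← e2, f1, f2] at m2
    simp at m2
    exact hr0.ne (by exact_mod_cast m2)
  · rw [e1, e2, m2, ← hD] at h'
    exact hr2 (by exact_mod_cast h')

theorem three {s : ℝ} (hs : 0 < s) (h : PresSq u v s) : PresSq u v (3 * s) := by
  have := kite h h h hs (by linarith) hs (by linarith) (by linarith)
  rwa [show 4 * s - s = 3 * s by ring] at this

theorem mid_image (m1 m2 a1 a2 b1 b2 c1 c2 d1 d2 s : ℂ) (hs : s ≠ 0)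
    (hc : (c1 - m1) ^ 2 + (c2 - m2) ^ 2 = s) (hd : (d1 - m1) ^ 2 + (d2 - m2) ^ 2 = s)
    (ha : (a1 - m1) ^ 2 + (a2 - m2) ^ 2 = s) (hb : (b1 - m1) ^ 2 + (b2 - m2) ^ 2 = s)
    (hcd : (c1 - d1) ^ 2 + (c2 - d2) ^ 2 = s)
    (hac : (a1 - c1) ^ 2 + (a2 - c2) ^ 2 = s) (hbd : (b1 - d1) ^ 2 + (b2 - d2) ^ 2 = s)
    (had : (a1 - d1) ^ 2 + (a2 - d2) ^ 2 = 3 * s) (hbc : (b1 - c1) ^ 2 + (b2 - c2) ^ 2 = 3 * s) :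
    a1 + b1 = 2 * m1 ∧ a2 + b2 = 2 * m2 := by
  obtain ⟨p1, hp1⟩ : ∃ p, p = a1 + b1 - 2 * m1 := ⟨_, rfl⟩
  obtain ⟨p2, hp2⟩ : ∃ p, p = a2 + b2 - 2 * m2 := ⟨_, rfl⟩
  obtain ⟨C1, hC1⟩ : ∃ p, p = c1 - m1 := ⟨_, rfl⟩
  obtain ⟨C2, hC2⟩ : ∃ p, p = c2 - m2 := ⟨_, rfl⟩
  obtain ⟨D1, hD1⟩ : ∃ p, p = d1 - m1 := ⟨_, rfl⟩
  obtain ⟨D2, hD2⟩ : ∃ p, p = d2 - m2 := ⟨_, rfl⟩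
  have e1 : p1 * C1 + p2 * C2 = 0 := by
    subst hp1 hp2 hC1 hC2; linear_combination hc + (ha + hb - hac - hbc) / 2
  have e2 : p1 * D1 + p2 * D2 = 0 := by
    subst hp1 hp2 hD1 hD2; linear_combination hd + (ha + hb - had - hbd) / 2
  have gC : C1 ^ 2 + C2 ^ 2 = s := by rw [hC1, hC2]; exact hc
  have gD : D1 ^ 2 + D2 ^ 2 = s := by rw [hD1, hD2]; exact hd
  have gCD : C1 * D1 + C2 * D2 = s / 2 := by
    subst hC1 hC2 hD1 hD2; linear_combination (hc + hd - hcd) / 2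
  have hdet : (C1 * D2 - C2 * D1) ^ 2 = 3 / 4 * s ^ 2 := by
    linear_combination (D1 ^ 2 + D2 ^ 2) * gC + s * gD - (C1 * D1 + C2 * D2 + s / 2) * gCD
  have hdet0 : C1 * D2 - C2 * D1 ≠ 0 := by
    intro h0
    rw [h0] at hdet
    apply hs
    have : s ^ 2 = 0 := by linear_combination -4 / 3 * hdet
    exact pow_eq_zero_iff (by norm_num) |>.1 this
  have q1 : p1 = 0 := by
    apply (mul_eq_zero.1 (?_ : (C1 * D2 - C2 * D1) * p1 = 0)).resolve_left hdet0
    linear_combination D2 * e1 - C2 * e2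
  have q2 : p2 = 0 := by
    apply (mul_eq_zero.1 (?_ : (C1 * D2 - C2 * D1) * p2 = 0)).resolve_left hdet0
    linear_combination C1 * e2 - D1 * e1
  constructor
  · linear_combination q1 - hp1
  · linear_combination q2 - hp2

theorem mid {s : ℝ} (hs : 0 < s) (h : PresSq u v s) (m1 m2 w1 w2 : ℝ) (hw : w1 ^ 2 + w2 ^ 2 = s) :
    u (m1 + w1) (m2 + w2) + u (m1 - w1) (m2 - w2) = 2 * u m1 m2 ∧
    v (m1 + w1) (m2 + w2) + v (m1 - w1) (m2 - w2) = 2 * v m1 m2 := by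
  have h3 := three hs h
  obtain ⟨r, hr⟩ : ∃ r : ℝ, r ^ 2 = 3 / 4 := ⟨√(3 / 4), Real.sq_sqrt (by norm_num)⟩
  have h3' : PresSq u v (3 * s) := h3
  have conv3 : ∀ x1 x2 y1 y2 : ℝ, (x1 - y1) ^ 2 + (x2 - y2) ^ 2 = 3 * s →
    (u x1 x2 - u y1 y2) ^ 2 + (v x1 x2 - v y1 y2) ^ 2 = 3 * (s : ℂ) := by
    intro x1 x2 y1 y2 hh
    have := h3 _ _ _ _ hh
    push_cast at this
    exact this
  apply mid_image (u m1 m2) (v m1 m2) _ _ _ _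
    (u (m1 + (w1 / 2 - r * w2)) (m2 + (w2 / 2 + r * w1)))
    (v (m1 + (w1 / 2 - r * w2)) (m2 + (w2 / 2 + r * w1)))
    (u (m1 + (- w1 / 2 - r * w2)) (m2 + (- w2 / 2 + r * w1)))
    (v (m1 + (- w1 / 2 - r * w2)) (m2 + (- w2 / 2 + r * w1))) s (by exact_mod_cast hs.ne')
  · apply h; linear_combination (1 / 4 + r ^ 2) * hw + s * hr
  · apply h; linear_combination (1 / 4 + r ^ 2) * hw + s * hr
  · apply h; linear_combination hw
  · apply h; linear_combination hw
  · apply h; linear_combination hw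
  · apply h; linear_combination (1 / 4 + r ^ 2) * hw + s * hr
  · apply h; linear_combination (1 / 4 + r ^ 2) * hw + s * hr
  · apply conv3; linear_combination (9 / 4 + r ^ 2) * hw + s * hr
  · apply conv3; linear_combination (9 / 4 + r ^ 2) * hw + s * hr

theorem affine {s : ℝ} (hs : 0 < s) (h : PresSq u v s) (m1 m2 w1 w2 : ℝ)
    (hw : w1 ^ 2 + w2 ^ 2 = s) (n : ℕ) :
    (u (m1 + n * w1) (m2 + n * w2) = u m1 m2 + n * (u (m1 + w1) (m2 + w2) - u m1 m2) ∧
    v (m1 + n * w1) (m2 + n * w2) = v m1 m2 + n * (v (m1 + w1) (m2 + w2) - v m1 m2)) := by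
  induction n using Nat.twoStepInduction with
  | zero => simp
  | one => simp
  | more n ih1 ih2 =>
    have := mid hs h (m1 + (n + 1 : ℕ) * w1) (m2 + (n + 1 : ℕ) * w2) w1 w2 hw
    rw [show m1 + (n + 1 : ℕ) * w1 - w1 = m1 + n * w1 by push_cast; ring,
      show m2 + (n + 1 : ℕ) * w2 - w2 = m2 + n * w2 by push_cast; ring,
      show m1 + (n + 1 : ℕ) * w1 + w1 = m1 + (n + 2 : ℕ) * w1 by push_cast; ring,
      show m2 + (n + 1 : ℕ) * w2 + w2 = m2 + (n + 2 : ℕ) * w2 by push_cast; ring,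
      ih1.1, ih1.2, ih2.1, ih2.2] at this
    push_cast at this ⊢
    constructor
    · linear_combination this.1
    · linear_combination this.2

theorem pres_mul {s : ℝ} (hs : 0 < s) (h : PresSq u v s) (n : ℕ) (hn : 0 < n) :
    PresSq u v (n ^ 2 * s) := by
  intro x1 x2 y1 y2 hxy
  have hn' : (n : ℝ) ≠ 0 := by exact_mod_cast hn.ne'
  have hw : ((x1 - y1) / n) ^ 2 + ((x2 - y2) / n) ^ 2 = s := by
    field_simp
    linear_combination hxy
  have := affine hs h y1 y2 _ _ hw n
  rw [show y1 + n * ((x1 - y1) / n) = x1 by field_simp; ring,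
    show y2 + n * ((x2 - y2) / n) = x2 by field_simp; ring] at this
  rw [this.1, this.2]
  have e := h (y1 + (x1 - y1) / n) (y2 + (x2 - y2) / n) y1 y2 (by linear_combination hw)
  push_cast
  linear_combination (n : ℂ) ^ 2 * e

theorem pres_div {s : ℝ} (hs : 0 < s) (h : PresSq u v s) (n : ℕ) (hn : 0 < n) :
    PresSq u v (s / n ^ 2) := by
  intro x1 x2 y1 y2 hxy
  have hn1 : (1 : ℝ) ≤ n := by exact_mod_cast hn
  have hn' : (n : ℝ) ≠ 0 := by exact_mod_cast hn.ne'
  have hnC : (n : ℂ) ≠ 0 := by exact_mod_cast hn.ne'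
  obtain ⟨-, z1, z2, -, -, h1, h2, -⟩ := apex x1 x2 y1 y2 (s / n ^ 2) s (by positivity) hxy (by
    have : s / n ^ 2 ≤ s := div_le_self hs.le (by nlinarith)
    linarith)
  have A := affine hs h z1 z2 (x1 - z1) (x2 - z2) (by linear_combination h1) n
  have B := affine hs h z1 z2 (y1 - z1) (y2 - z2) (by linear_combination h2) n
  simp only [add_sub_cancel] at A B
  have e := h (z1 + n * (x1 - z1)) (z2 + n * (x2 - z2)) (z1 + n * (y1 - z1)) (z2 + n * (y2 - z2)) (by
    field_simp at hxy
    linear_combination hxy)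
  rw [A.1, A.2, B.1, B.2] at e
  push_cast
  rw [eq_div_iff (by positivity)]
  linear_combination e

theorem pres_ratsq (h : PresSq u v 1) (q : ℚ) (hq : 0 < q) : PresSq u v ((q : ℝ) ^ 2) := by
  have hnum : 0 < q.num := Rat.num_pos.2 hq
  obtain ⟨n, hn⟩ := Int.eq_ofNat_of_zero_le hnum.le
  have hn0 : 0 < n := by omega
  have h1 := pres_mul one_pos h n hn0
  have h2 := pres_div (by positivity) h1 q.den q.den_pos
  have : (q : ℝ) = n / q.den := by
    rw [Rat.cast_def, hn]; simp
  rw [this, div_pow]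
  simpa using h2

theorem pres_rat (h : PresSq u v 1) (q : ℚ) (hq : 0 < q) : PresSq u v q := by
  have hq1 : 0 < q + 1 := by linarith
  obtain ⟨s, hs⟩ : ∃ s : ℚ, s = q / (q + 1) := ⟨_, rfl⟩
  have hs0 : 0 < s := by rw [hs]; positivity
  have hsq : s * (q + 1) = q := by rw [hs]; field_simp
  have hs1 : s < 1 := by nlinarith
  have hsltq : s < q := by nlinarith
  have hs2 : s ^ 2 < q := by nlinarith
  have hb := pres_ratsq h ((q + 1 + s) / 4) (by positivity)
  have ha := pres_ratsq h ((q + 1 - s) / 2) (by linarith)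
  have hr := pres_ratsq h s hs0
  have e : 4 * ((((q + 1 + s) / 4 : ℚ) : ℝ)) ^ 2 - (((q + 1 - s) / 2 : ℚ) : ℝ) ^ 2 = q := by
    have : 4 * ((q + 1 + s) / 4) ^ 2 - ((q + 1 - s) / 2) ^ 2 = q := by linear_combination hsq
    exact_mod_cast this
  have hq' : (0 : ℝ) < q := by exact_mod_cast hq
  have hs2' : (s : ℝ) ^ 2 < q := by exact_mod_cast hs2
  have hs0' : (0 : ℝ) < s := by exact_mod_cast hs0
  have hpos : (0 : ℚ) < (q + 1 - s) / 2 := by linarith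
  have hpos' : (0 : ℝ) < (((q + 1 - s) / 2 : ℚ) : ℝ) := by exact_mod_cast hpos
  have := kite ha hb hr (by positivity) (by linarith) (by positivity) (by rw [e]; linarith)
    (by rw [e]; exact hs2'.ne)
  rwa [e] at this

end

/-- **Corollary 1** (`A₂(ℂ) = {d > 0 : d² ∈ ℚ}`). A positive real `d` has the
property that every unit-distance preserving map `f : ℝ² → ℂ²` satisfies
`φ₂(f x, f y) = d²` whenever `|x - y| = d`, if and only if `d²` is rational. -/
theorem stmt_3 (d : ℝ) (hd : 0 < d) :
    (∀ f : EuclideanSpace ℝ (Fin 2) → (Fin 2 → ℂ),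
      (∀ x y : EuclideanSpace ℝ (Fin 2), dist x y = 1 →
        ∑ i, (f x i - f y i) ^ 2 = 1) →
      ∀ x y : EuclideanSpace ℝ (Fin 2), dist x y = d →
        ∑ i, (f x i - f y i) ^ 2 = (d : ℂ) ^ 2)
    ↔ ∃ q : ℚ, (q : ℝ) = d ^ 2 := by
  have hdist : ∀ (x y : EuclideanSpace ℝ (Fin 2)) (r : ℝ), 0 < r →
      (dist x y = r ↔ (x 0 - y 0) ^ 2 + (x 1 - y 1) ^ 2 = r ^ 2) := by
    intro x y r hr
    rw [EuclideanSpace.dist_eq, Fin.sum_univ_two, Real.dist_eq, Real.dist_eq, sq_abs, sq_abs,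
      Real.sqrt_eq_iff_eq_sq (by positivity) hr.le]
  constructor
  · intro H
    by_contra! hirr
    obtain ⟨σ, hσ⟩ := exists_hom_moving (d ^ 2) hirr
    have hsum : ∀ x y : EuclideanSpace ℝ (Fin 2), ∑ i, (σ (x i) - σ (y i)) ^ 2
        = σ ((x 0 - y 0) ^ 2 + (x 1 - y 1) ^ 2) := by
      intro x y
      simp [Fin.sum_univ_two]
    have h1 := H (fun x i => σ (x i)) (fun x y hxy => by
      rw [hdist x y 1 one_pos] at hxy
      rw [hsum, hxy]; simp) !₂[d, 0] !₂[0, 0] (by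
      rw [hdist _ _ d hd]; simp)
    rw [hsum] at h1
    apply hσ
    simpa using h1
  · rintro ⟨q, hq⟩ f hf x y hxy
    have hP : PresSq (fun a b => f !₂[a, b] 0) (fun a b => f !₂[a, b] 1) 1 := by
      intro x1 x2 y1 y2 h
      have := hf !₂[x1, x2] !₂[y1, y2] (by rw [hdist _ _ 1 one_pos]; simpa using h)
      rw [Fin.sum_univ_two] at this
      simpa using this
    have hq0 : 0 < q := by
      have : (0 : ℝ) < q := by rw [hq]; positivity
      exact_mod_cast this
    have hx : ∀ x : EuclideanSpace ℝ (Fin 2), !₂[x 0, x 1] = x := by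
      intro x
      ext i
      fin_cases i <;> simp
    have := pres_rat hP q hq0 (x 0) (x 1) (y 0) (y 1) (by
      rw [hq]; exact (hdist x y d hd).1 hxy)
    beta_reduce at this
    rw [hx, hx, hq] at this
    rw [Fin.sum_univ_two]
    simpa using this
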